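/- Let ÷ be a belief change operator and Ψ ↦ ≤_Ψ a faithful assignment representing ÷ that satisfies (CR8): for all Ψ, α and ω₁, ω₂ ∈ α, ω₁ ≤_Ψ ω₂ ⟺ ω₁ ≤_{Ψ÷α} ω₂. Then ÷ satisfies (C8): for all Ψ, α, β with ¬α ⊨ β, Mod(Ψ÷α÷β) ∩ α = Mod(Ψ÷β) ∩ α. -/

import Mathlib

namespace IteratedContraction

variable {W E : Type*}

/-- A total preorder: reflexive, transitive and total relation. -/
def IsTotalPreorder (r : W → W → Prop) : Prop :=
  Reflexive r ∧ Transitive r ∧ ∀ x y, r x y ∨ r y x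

/-- `minSet r S` is the set of `r`-minimal elements of `S`. -/
def minSet (r : W → W → Prop) (S : Set W) : Set W :=
  {ω | ω ∈ S ∧ ∀ ω' ∈ S, r ω ω'}

/-- Strict variant of a (total pre)order. -/
def strictLt (r : W → W → Prop) (x y : W) : Prop := r x y ∧ ¬ r y x

/-- A faithful assignment maps each epistemic state to a total preorder on worlds
such that all models of the state are mutually equivalent (FA1) and strictly below
every non-model (FA2). -/
def FaithfulAssignment (Mod : E → Set W) (le : E → W → W → Prop) : Prop :=
  (∀ Ψ, IsTotalPreorder (le Ψ)) ∧
  (∀ Ψ, ∀ ω₁ ∈ Mod Ψ, ∀ ω₂ ∈ Mod Ψ, le Ψ ω₁ ω₂ ∧ le Ψ ω₂ ω₁) ∧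
  (∀ Ψ, ∀ ω₁ ∈ Mod Ψ, ∀ ω₂, ω₂ ∉ Mod Ψ → strictLt (le Ψ) ω₁ ω₂)

/-- The assignment represents the contraction `div`:
`Mod (Ψ ÷ α) = Mod Ψ ∪ min(¬α, ≤_Ψ)`. -/
def Represents (Mod : E → Set W) (div : E → Set W → E) (le : E → W → W → Prop) : Prop :=
  ∀ Ψ α, Mod (div Ψ α) = Mod Ψ ∪ minSet (le Ψ) αᶜ

/-- (C8): if ¬α ⊨ β then Bel(Ψ÷α÷β) =_α Bel(Ψ÷β). -/
def C8 (Mod : E → Set W) (div : E → Set W → E) : Prop :=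
  ∀ (Ψ : E) (α β : Set W), αᶜ ⊆ β →
    Mod (div (div Ψ α) β) ∩ α = Mod (div Ψ β) ∩ α

/-- (C9): if α ⊨ β then Bel(Ψ÷α÷β) =_{¬β} Bel(Ψ÷β). -/
def C9 (Mod : E → Set W) (div : E → Set W → E) : Prop :=
  ∀ (Ψ : E) (α β : Set W), α ⊆ β →
    Mod (div (div Ψ α) β) ∩ βᶜ = Mod (div Ψ β) ∩ βᶜ

/-- (C10): if ¬α ⊨ γ then Ψ÷β ⊨ γ implies Ψ÷α÷β ⊨ γ. -/
def C10 (Mod : E → Set W) (div : E → Set W → E) : Prop :=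
  ∀ (Ψ : E) (α β γ : Set W), αᶜ ⊆ γ →
    Mod (div Ψ β) ⊆ γ → Mod (div (div Ψ α) β) ⊆ γ

/-- (C11): if α ⊨ γ then Ψ÷α÷β ⊨ γ implies Ψ÷β ⊨ γ. -/
def C11 (Mod : E → Set W) (div : E → Set W → E) : Prop :=
  ∀ (Ψ : E) (α β γ : Set W), α ⊆ γ →
    Mod (div (div Ψ α) β) ⊆ γ → Mod (div Ψ β) ⊆ γ

/-- (C8cond): if ¬α ⊨ β then Ψ÷α ⊨ ((γ ∨ ¬α) ⇃ β) ⟺ Ψ ⊨ ((γ ∨ ¬α) ⇃ β). -/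
def C8cond (Mod : E → Set W) (div : E → Set W → E) : Prop :=
  ∀ (Ψ : E) (α β γ : Set W), αᶜ ⊆ β →
    (Mod (div (div Ψ α) β) ⊆ γ ∪ αᶜ ↔ Mod (div Ψ β) ⊆ γ ∪ αᶜ)

/-- (C9cond): if α ⊨ β then Ψ÷α ⊨ ((γ ∨ β) ⇃ β) ⟺ Ψ ⊨ ((γ ∨ β) ⇃ β). -/
def C9cond (Mod : E → Set W) (div : E → Set W → E) : Prop :=
  ∀ (Ψ : E) (α β γ : Set W), α ⊆ β →
    (Mod (div (div Ψ α) β) ⊆ γ ∪ β ↔ Mod (div Ψ β) ⊆ γ ∪ β)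

/-- (C10cond): if ¬α ⊨ γ then Ψ ⊨ (γ ⇃ β) implies Ψ÷α ⊨ (γ ⇃ β). -/
def C10cond (Mod : E → Set W) (div : E → Set W → E) : Prop :=
  ∀ (Ψ : E) (α β γ : Set W), αᶜ ⊆ γ →
    Mod (div Ψ β) ⊆ γ → Mod (div (div Ψ α) β) ⊆ γ

/-- (C11cond): if α ⊨ γ then Ψ÷α ⊨ (γ ⇃ β) implies Ψ ⊨ (γ ⇃ β). -/
def C11cond (Mod : E → Set W) (div : E → Set W → E) : Prop :=
  ∀ (Ψ : E) (α β γ : Set W), α ⊆ γ →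
    Mod (div (div Ψ α) β) ⊆ γ → Mod (div Ψ β) ⊆ γ

/-- (IC8): Bel(Φ) ⊆ Bel(Φ') is rendered as Mod(Φ') ⊆ Mod(Φ). -/
def IC8 (Mod : E → Set W) (div : E → Set W → E) : Prop :=
  ∀ (Ψ : E) (α β γ : Set W), αᶜ ⊆ γ →
    (Mod (div Ψ (α ∪ β)) ⊆ Mod (div Ψ α) ↔
      Mod (div (div Ψ γ) (α ∪ β)) ⊆ Mod (div (div Ψ γ) α))

def IC9 (Mod : E → Set W) (div : E → Set W → E) : Prop :=
  ∀ (Ψ : E) (α β γ : Set W), γ ⊆ α →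
    (Mod (div Ψ (α ∪ β)) ⊆ Mod (div Ψ α) ↔
      Mod (div (div Ψ γ) (α ∪ β)) ⊆ Mod (div (div Ψ γ) α))

def IC10 (Mod : E → Set W) (div : E → Set W → E) : Prop :=
  ∀ (Ψ : E) (α β γ : Set W), βᶜ ⊆ γ →
    (Mod (div (div Ψ γ) (α ∪ β)) ⊆ Mod (div (div Ψ γ) α) →
      Mod (div Ψ (α ∪ β)) ⊆ Mod (div Ψ α))

def IC11 (Mod : E → Set W) (div : E → Set W → E) : Prop :=
  ∀ (Ψ : E) (α β γ : Set W), γ ⊆ β →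
    (Mod (div (div Ψ γ) (α ∪ β)) ⊆ Mod (div (div Ψ γ) α) →
      Mod (div Ψ (α ∪ β)) ⊆ Mod (div Ψ α))

/-- (CR8): worlds inside α keep their relative order after contraction by α. -/
def CR8 (div : E → Set W → E) (le : E → W → W → Prop) : Prop :=
  ∀ (Ψ : E) (α : Set W), ∀ ω₁ ∈ α, ∀ ω₂ ∈ α,
    (le Ψ ω₁ ω₂ ↔ le (div Ψ α) ω₁ ω₂)

/-- (CR9): worlds inside ¬α keep their relative order after contraction by α. -/
def CR9 (div : E → Set W → E) (le : E → W → W → Prop) : Prop :=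
  ∀ (Ψ : E) (α : Set W), ∀ ω₁ ∈ αᶜ, ∀ ω₂ ∈ αᶜ,
    (le Ψ ω₁ ω₂ ↔ le (div Ψ α) ω₁ ω₂)

/-- (CR10). -/
def CR10 (div : E → Set W → E) (le : E → W → W → Prop) : Prop :=
  ∀ (Ψ : E) (α : Set W), ∀ ω₁ ∈ αᶜ, ∀ ω₂ ∈ α,
    strictLt (le Ψ) ω₁ ω₂ → strictLt (le (div Ψ α)) ω₁ ω₂

/-- (CR11). -/
def CR11 (div : E → Set W → E) (le : E → W → W → Prop) : Prop :=
  ∀ (Ψ : E) (α : Set W), ∀ ω₁ ∈ αᶜ, ∀ ω₂ ∈ α,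
    le Ψ ω₁ ω₂ → le (div Ψ α) ω₁ ω₂

end IteratedContraction

open IteratedContraction

/-- Two relations that agree on `S` have the same minimal elements of `S`. -/
theorem minSet_congr {W : Type*} {r s : W → W → Prop} {S : Set W}
    (h : ∀ x ∈ S, ∀ y ∈ S, (r x y ↔ s x y)) : minSet r S = minSet s S := by
  ext x
  exact and_congr_right fun hx => forall₂_congr fun y hy => h x hx y hy

theorem cr8_implies_c8 {W E : Type*} [Finite W] [Nonempty W]
    (Mod : E → Set W) (div : E → Set W → E)
    (le : E → W → W → Prop)
    (hfa : FaithfulAssignment Mod le) (hrep : Represents Mod div le)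
    (hcr8 : CR8 div le) :
    C8 Mod div := by
  intro Ψ α β hαβ
  have hmin : minSet (le (div Ψ α)) βᶜ = minSet (le Ψ) βᶜ :=
    minSet_congr fun x hx y hy =>
      (hcr8 Ψ α x (Set.compl_subset_comm.mp hαβ hx) y (Set.compl_subset_comm.mp hαβ hy)).symm
  have hdisj : minSet (le Ψ) αᶜ ∩ α = ∅ :=
    Set.eq_empty_of_forall_notMem fun _ hx => hx.1.1 hx.2
  rw [hrep, hrep, hrep, hmin, Set.union_inter_distrib_right, Set.union_inter_distrib_right,
    hdisj, Set.union_empty, ← Set.union_inter_distrib_right]
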